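/- In the sequent calculus for additive linear logic ALL (without units), every derivable sequent Γ ⊢ Δ contains exactly two formula occurrences in total, i.e. |Γ| + |Δ| = 2. Consequently, every MALL-inconsistent multiset of ALL formulas has a submultiset of cardinality exactly 2 that is inconsistent, and every minimally inconsistent multiset of ALL formulas has cardinality 2. -/

import Mathlib

namespace Stmt12

/-- Formulas of additive linear logic (ALL): atoms, linear negation, & and ⊕, no units. -/
inductive AForm : Type
  | atom  : ℕ → AForm
  | neg   : AForm → AForm
  | awith : AForm → AForm → AForm         -- &
  | aplus : AForm → AForm → AForm         -- ⊕
  deriving DecidableEq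

/-- Two-sided sequent calculus for ALL on multisets (no weakening, no contraction). -/
inductive ADeriv : Multiset AForm → Multiset AForm → Prop
  | ax (A) : ADeriv {A} {A}
  | cut {Γ Δ Γ' Δ' A} : ADeriv (A ::ₘ Γ) Δ → ADeriv Γ' (A ::ₘ Δ') →
      ADeriv (Γ + Γ') (Δ + Δ')
  | negL {Γ Δ A} : ADeriv Γ (A ::ₘ Δ) → ADeriv (AForm.neg A ::ₘ Γ) Δ
  | negR {Γ Δ A} : ADeriv (A ::ₘ Γ) Δ → ADeriv Γ (AForm.neg A ::ₘ Δ)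
  | withR {Γ Δ A B} : ADeriv Γ (A ::ₘ Δ) → ADeriv Γ (B ::ₘ Δ) →
      ADeriv Γ (AForm.awith A B ::ₘ Δ)
  | withL1 {Γ Δ A B} : ADeriv (A ::ₘ Γ) Δ → ADeriv (AForm.awith A B ::ₘ Γ) Δ
  | withL2 {Γ Δ A B} : ADeriv (B ::ₘ Γ) Δ → ADeriv (AForm.awith A B ::ₘ Γ) Δ
  | plusL {Γ Δ A B} : ADeriv (A ::ₘ Γ) Δ → ADeriv (B ::ₘ Γ) Δ →
      ADeriv (AForm.aplus A B ::ₘ Γ) Δ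
  | plusR1 {Γ Δ A B} : ADeriv Γ (A ::ₘ Δ) → ADeriv Γ (AForm.aplus A B ::ₘ Δ)
  | plusR2 {Γ Δ A B} : ADeriv Γ (B ::ₘ Δ) → ADeriv Γ (AForm.aplus A B ::ₘ Δ)

/-- ALL-inconsistency: Γ ⊢ (empty succedent) is derivable. -/
def AInconsistent (Γ : Multiset AForm) : Prop := ADeriv Γ 0

/-- Robust consistency in ALL: every submultiset is ALL-consistent. -/
def robustlyConsistent (Γ : Multiset AForm) : Prop :=
  ∀ Δ : Multiset AForm, Δ ≤ Γ → ¬ AInconsistent Δ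

/-- The complement ∼φ. -/
def AForm.compl : AForm → AForm
  | .neg ψ => ψ
  | φ      => .neg φ

def completeOn (Φ J : Finset AForm) : Prop := ∀ φ ∈ Φ, φ ∈ J ∨ φ.compl ∈ J

def complementFree (J : Finset AForm) : Prop := ∀ φ ∈ J, φ.compl ∉ J

def nsupp (n : ℕ) (J : Fin n → Finset AForm) (φ : AForm) : ℕ :=
  (Finset.univ.filter (fun i => φ ∈ J i)).card

/-- The majority rule. -/
def maj (n : ℕ) (Φ : Finset AForm) (J : Fin n → Finset AForm) : Finset AForm :=
  Φ.filter (fun φ => n < 2 * nsupp n J φ)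

/-- in the sequent calculus for ALL (without units), every derivable
sequent Γ ⊢ Δ contains exactly two formula occurrences, i.e. |Γ| + |Δ| = 2.
Consequently every ALL-inconsistent multiset has a submultiset of cardinality exactly 2
that is inconsistent, and every minimally inconsistent multiset has cardinality 2. -/
theorem all_sequents_have_two_formulas :
    (∀ Γ Δ : Multiset AForm, ADeriv Γ Δ → Multiset.card Γ + Multiset.card Δ = 2) ∧
    (∀ Γ : Multiset AForm, AInconsistent Γ →
      ∃ Δ ≤ Γ, Multiset.card Δ = 2 ∧ AInconsistent Δ) ∧
    (∀ Γ : Multiset AForm, AInconsistent Γ → (∀ Δ < Γ, ¬ AInconsistent Δ) →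
      Multiset.card Γ = 2) := by
  have key : ∀ Γ Δ : Multiset AForm, ADeriv Γ Δ →
      Multiset.card Γ + Multiset.card Δ = 2 := by
    intro Γ Δ h
    induction h <;> simp only [Multiset.card_cons, Multiset.card_add,
      Multiset.card_singleton] at * <;> omega
  have key0 : ∀ Γ : Multiset AForm, AInconsistent Γ → Multiset.card Γ = 2 := by
    intro Γ h
    simpa using key Γ 0 h
  exact ⟨key, fun Γ h => ⟨Γ, le_rfl, key0 Γ h, h⟩, fun Γ h _ => key0 Γ h⟩

end Stmt12
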